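/- arXiv:1002.2421 — 2 statements merged into one kernel-verified Lean document; each statement's English description precedes it below -/
import Mathlib

section
/- Let U be a d×d real-valued invertible matrix and let ψ, ψ̃ be locally square-integrable functions on ℝ^d. Then for all compactly supported C^∞ functions f, g on ℝ^d, Σ_{k∈ℤ^d} ⟨f, ψ_{U;0,k}⟩⟨ψ̃_{U;0,k}, g⟩ = (2π)^d ∫_{ℝ^d} Σ_{k∈ℤ^d} f(ξ) \overline{g(ξ+2πU^{-1}k)} \overline{ψ(Uξ)} ψ̃(Uξ+2πk) dξ, with the series on the left-hand side converging absolutely; moreover the sum over k on the right-hand side has only finitely many nonzero terms. -/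
open MeasureTheory Filter Complex Topology
open scoped Real

noncomputable section

/-- Complex-valued functions on `ℝ^d`. -/
abbrev CF (d : ℕ) := (Fin d → ℝ) → ℂ

/-- An integer vector regarded as a real vector. -/
def iv {d : ℕ} (k : Fin d → ℤ) : Fin d → ℝ := fun i => (k i : ℝ)

/-- `f_{U;k}(x) = |det U|^{1/2} f(Ux - k)`. -/
def wdil {d : ℕ} (U : Matrix (Fin d) (Fin d) ℝ) (k : Fin d → ℤ) (f : CF d) : CF d :=
  fun x => (Real.sqrt |U.det| : ℂ) * f (U.mulVec x - iv k)

/-- The `L²` inner product `⟨f,g⟩ = ∫ f · conj g`. -/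
def ip {d : ℕ} (f g : CF d) : ℂ := ∫ x, f x * (starRingEnd ℂ) (g x)

/-- The squared `L²` norm. -/
def nsq {d : ℕ} (f : CF d) : ℝ := ∫ x, ‖f x‖ ^ 2

/-- All complex eigenvalues have modulus greater than one. -/
def Expansive {d : ℕ} (M : Matrix (Fin d) (Fin d) ℝ) : Prop :=
  ∀ μ ∈ spectrum ℂ (M.map (Complex.ofReal : ℝ → ℂ)), 1 < ‖μ‖

/-- Real dot product on `ℝ^d`. -/
def dotR {d : ℕ} (x y : Fin d → ℝ) : ℝ := ∑ i, x i * y i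

/-- The frequency-based dilation `h_{U;0,k}(x) = |det U|^{1/2} e^{-i k·Ux} h(Ux)`. -/
def fdil {d : ℕ} (U : Matrix (Fin d) (Fin d) ℝ) (k : Fin d → ℤ) (f : CF d) : CF d :=
  fun x => (Real.sqrt |U.det| : ℂ) *
    Complex.exp (-Complex.I * (dotR (iv k) (U.mulVec x) : ℝ)) * f (U.mulVec x)

/-- `f` is locally square integrable on `ℝ^d`. -/
def LocL2 {d : ℕ} (f : CF d) : Prop :=
  ∀ K : Set (Fin d → ℝ), IsCompact K → MemLp f 2 (volume.restrict K)

/-- `f` is a compactly supported `C^∞` test function. -/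
def IsTest {d : ℕ} (f : CF d) : Prop := ContDiff ℝ (⊤ : ℕ∞) f ∧ HasCompactSupport f

namespace S8
open scoped Pointwise
attribute [local instance] instMeasureSpaceUnitAddCircle

/-- half open unit cube -/
def Q (d : ℕ) : Set (Fin d → ℝ) := {x | ∀ i, x i ∈ Set.Ioc ((0 : Fin d → ℝ) i) ((0 : Fin d → ℝ) i + 1)}

lemma measQ (d : ℕ) : MeasurableSet (Q d) :=
  MeasurableSet.univ_pi' (fun _ => measurableSet_Ioc)

/-- character -/
def ch {d : ℕ} (k : Fin d → ℤ) (x : Fin d → ℝ) : ℂ :=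
  Complex.exp (-(2 * π * Complex.I * (dotR (iv k) x : ℝ)))

lemma mF {d : ℕ} (k : Fin d → ℤ) (x : Fin d → ℝ) :
    UnitAddTorus.mFourier (-k) (fun i => ((x i : ℝ) : UnitAddCircle)) = ch k x := by
  simp only [UnitAddTorus.mFourier, ContinuousMap.coe_mk, fourier_coe_apply, ch, dotR, iv]
  rw [← Complex.exp_sum]
  congr 1
  push_cast
  rw [Finset.mul_sum, ← Finset.sum_neg_distrib]
  refine Finset.sum_congr rfl fun i _ => ?_
  simp
  ring

lemma parsevalQ {d : ℕ} (F G : CF d) (hF : MemLp F 2 (volume.restrict (Q d)))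
    (hG : MemLp G 2 (volume.restrict (Q d))) :
    HasSum (fun k : Fin d → ℤ => (starRingEnd ℂ) (∫ x in Q d, ch k x * F x) *
      ∫ x in Q d, ch k x * G x) (∫ x in Q d, (starRingEnd ℂ) (F x) * G x) := by
  have mp : MeasurePreserving (fun x : UnitAddTorus (Fin d) =>
      ((UnitAddTorus.measurableEquivPiIoc (0 : Fin d → ℝ) x).1 : Fin d → ℝ)) volume
      (volume.restrict (Q d)) :=
    (measurePreserving_subtype_coe (measQ d)).comp (UnitAddTorus.measurePreserving_equivPiIoc 0)
  have key : ∀ x ∈ Q d, ((UnitAddTorus.measurableEquivPiIoc (0 : Fin d → ℝ)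
      (fun i => ((x i : ℝ) : UnitAddCircle))).1 : Fin d → ℝ) = x := by
    intro x hx
    have := (UnitAddTorus.measurableEquivPiIoc (0 : Fin d → ℝ)).apply_symm_apply ⟨x, hx⟩
    exact congrArg Subtype.val this
  have hF' := hF.comp_measurePreserving mp
  have hG' := hG.comp_measurePreserving mp
  have co : ∀ (H : CF d) (hH : MemLp (H ∘ (fun x : UnitAddTorus (Fin d) =>
      ((UnitAddTorus.measurableEquivPiIoc (0 : Fin d → ℝ) x).1 : Fin d → ℝ))) 2 volume)
      (k : Fin d → ℤ),
      UnitAddTorus.mFourierCoeff (hH.toLp) k = ∫ x in Q d, ch k x * H x := by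
    intro H hH k
    have h1 : UnitAddTorus.mFourierCoeff (hH.toLp) k = UnitAddTorus.mFourierCoeff (H ∘ (fun x : UnitAddTorus (Fin d) =>
      ((UnitAddTorus.measurableEquivPiIoc (0 : Fin d → ℝ) x).1 : Fin d → ℝ))) k := by
      refine integral_congr_ae ?_
      filter_upwards [hH.coeFn_toLp] with x hx
      rw [hx]
    rw [h1, UnitAddTorus.mFourierCoeff_eq_integral _ k 0]
    refine setIntegral_congr_fun (measQ d) fun x hx => ?_
    simp only [mF, Function.comp, key x hx, smul_eq_mul]
  have := UnitAddTorus.hasSum_prod_mFourierCoeff hF'.toLp hG'.toLp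
  simp only [co] at this
  convert this using 1
  rw [eq_comm]
  have h2 : ∫ t, (starRingEnd ℂ) (hF'.toLp _ t) * (hG'.toLp _ t) =
      ∫ t, (fun t => (starRingEnd ℂ) (F t) * G t) (UnitAddTorus.measurableEquivPiIoc (0 : Fin d → ℝ) t).1 := by
    refine integral_congr_ae ?_
    filter_upwards [hF'.coeFn_toLp, hG'.coeFn_toLp] with x hx hy
    rw [hx, hy]; rfl
  rw [h2, UnitAddTorus.integral_preimage _ 0]
  refine setIntegral_congr_fun (measQ d) fun x hx => ?_
  simp only [key x hx]

lemma fold {d : ℕ} (S : Finset (Fin d → ℤ)) (H : CF d)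
    (hi : ∀ m ∈ S, IntegrableOn (fun x => H (x + iv m)) (Q d))
    (hz : ∀ x ∈ Q d, ∀ m ∉ S, H (x + iv m) = 0) :
    ∫ x, H x = ∑ m ∈ S, ∫ x in Q d, H (x + iv m) := by
  let C : (Fin d → ℤ) → Set (Fin d → ℝ) := fun m => (fun x => x - iv m) ⁻¹' (Q d)
  have mpm : ∀ m : Fin d → ℤ, MeasurePreserving (fun x : Fin d → ℝ => x + iv m)
      (volume.restrict (Q d)) (volume.restrict (C m)) := by
    intro m
    have h := (measurePreserving_add_right (volume : Measure (Fin d → ℝ)) (iv m)).restrict_preimage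
      (s := C m) ((measurable_sub_const (iv m)) (measQ d))
    convert h using 2
    ext x; simp [C]
  have emb : ∀ m : Fin d → ℤ, MeasurableEmbedding (fun x : Fin d → ℝ => x + iv m) := fun m =>
    measurableEmbedding_addRight (iv m)
  have h1 : ∫ x in ⋃ m ∈ S, C m, H x = ∫ x, H x := by
    apply setIntegral_eq_integral_of_forall_compl_eq_zero
    intro x hx
    let m : Fin d → ℤ := fun i => ⌈x i⌉ - 1
    have hxm : x - iv m ∈ Q d := by
      intro i
      have := Int.ceil_lt_add_one (x i)
      have := Int.le_ceil (x i)
      simp only [Pi.sub_apply, iv, m, Pi.zero_apply, Set.mem_Ioc]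
      push_cast
      constructor <;> linarith
    have hm : m ∉ S := by
      intro hm
      exact hx (Set.mem_biUnion hm hxm)
    have := hz _ hxm m hm
    simpa using this
  rw [← h1, integral_biUnion_finset]
  · refine Finset.sum_congr rfl fun m hm => ?_
    rw [← (mpm m).integral_comp (emb m)]
  · intro m _
    exact (measurable_sub_const (iv m)) (measQ d)
  · intro m _ n _ hmn
    refine Set.disjoint_left.2 fun x hx hy => hmn ?_
    funext i
    have h1 := hx i
    have h2 := hy i
    simp only [Pi.sub_apply, iv, Pi.zero_apply, Set.mem_Ioc] at h1 h2
    have a1 : (m i : ℝ) < n i + 1 := by linarith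
    have a2 : (n i : ℝ) < m i + 1 := by linarith
    have a1 : m i < n i + 1 := by exact_mod_cast a1
    have a2 : n i < m i + 1 := by exact_mod_cast a2
    omega
  · intro m hm
    exact ((mpm m).integrable_comp_emb (emb m)).1 (hi m hm)

lemma ivfin {d : ℕ} (K : Set (Fin d → ℝ)) (hK : Bornology.IsBounded K) :
    {k : Fin d → ℤ | iv k ∈ K}.Finite := by
  obtain ⟨R, hR⟩ := hK.exists_norm_le
  refine (Set.finite_Icc (fun _ : Fin d => -⌈R⌉) (fun _ => ⌈R⌉)).subset ?_
  intro k hk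
  have h : ∀ i, |(k i : ℝ)| ≤ ⌈R⌉ := fun i =>
    ((norm_le_pi_norm (iv k) i).trans (hR _ hk)).trans (Int.le_ceil R)
  constructor
  · intro i
    have := (abs_le.1 (h i)).1
    exact_mod_cast this
  · intro i
    have := (abs_le.1 (h i)).2
    exact_mod_cast this

lemma ch_add {d : ℕ} (k m : Fin d → ℤ) (x : Fin d → ℝ) : ch k (x + iv m) = ch k x := by
  rw [← mF, ← mF]
  congr 1
  funext i
  simp [iv]

lemma ch_norm {d : ℕ} (k : Fin d → ℤ) (x : Fin d → ℝ) : ‖ch k x‖ = 1 := by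
  rw [ch, Complex.norm_exp]; simp

lemma ch_cont {d : ℕ} (k : Fin d → ℤ) : Continuous (ch k) := by
  unfold ch dotR; fun_prop

lemma Qfin (d : ℕ) : volume (Q d) < ⊤ := by
  refine lt_of_le_of_lt (measure_mono (t := Metric.closedBall 0 1) ?_) measure_closedBall_lt_top
  intro x hx
  rw [mem_closedBall_zero_iff, pi_norm_le_iff_of_nonneg zero_le_one]
  intro i
  have := hx i
  simp only [Pi.zero_apply, Set.mem_Ioc] at this
  rw [Real.norm_eq_abs, abs_le]; constructor <;> linarith

lemma Qbdd (d : ℕ) : Bornology.IsBounded (Q d) := by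
  refine (Metric.isBounded_closedBall (x := (0 : Fin d → ℝ)) (r := 1)).subset ?_
  intro x hx
  rw [mem_closedBall_zero_iff, pi_norm_le_iff_of_nonneg zero_le_one]
  intro i
  have := hx i
  simp only [Pi.zero_apply, Set.mem_Ioc] at this
  rw [Real.norm_eq_abs, abs_le]; constructor <;> linarith

lemma core {d : ℕ} (F G : CF d) (hF : MemLp F 2 volume) (hG : MemLp G 2 volume)
    (K : Set (Fin d → ℝ)) (hK : IsCompact K) (hFK : ∀ x ∉ K, F x = 0) (hGK : ∀ x ∉ K, G x = 0) :
    HasSum (fun k : Fin d → ℤ => (starRingEnd ℂ) (∫ x, ch k x * F x) * ∫ x, ch k x * G x)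
      (∫ x, (starRingEnd ℂ) (F x) * ∑' m, G (x + iv m)) := by
  have : IsFiniteMeasure (volume.restrict (Q d)) := ⟨by simpa using Qfin d⟩
  have hfin := ivfin (K - Q d) (hK.isBounded.sub (Qbdd d))
  set S := hfin.toFinset with hS
  have hout : ∀ x ∈ Q d, ∀ m ∉ S, x + iv m ∉ K := by
    intro x hx m hm h
    apply hm
    rw [hS, Set.Finite.mem_toFinset]
    exact ⟨_, h, x, hx, by simp⟩
  have hFm : ∀ m : Fin d → ℤ, MemLp (fun x => F (x + iv m)) 2 (volume.restrict (Q d)) := fun m =>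
    (hF.comp_measurePreserving (measurePreserving_add_right volume (iv m))).restrict _
  have hGm : ∀ m : Fin d → ℤ, MemLp (fun x => G (x + iv m)) 2 (volume.restrict (Q d)) := fun m =>
    (hG.comp_measurePreserving (measurePreserving_add_right volume (iv m))).restrict _
  have hPF := memLp_finsetSum S (fun m _ => hFm m)
  have hPG := memLp_finsetSum S (fun m _ => hGm m)
  have hco : ∀ (H : CF d) (_ : ∀ m : Fin d → ℤ, MemLp (fun x => H (x + iv m)) 2 (volume.restrict (Q d)))
      (_ : ∀ x ∉ K, H x = 0) (k : Fin d → ℤ),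
      ∫ x in Q d, ch k x * ∑ m ∈ S, H (x + iv m) = ∫ x, ch k x * H x := by
    intro H hH hHK k
    have hint : ∀ m, IntegrableOn (fun x => ch k x * H (x + iv m)) (Q d) := fun m =>
      ((hH m).integrable (by norm_num)).bdd_mul (c := 1) (ch_cont k).aestronglyMeasurable
        (Eventually.of_forall fun x => (ch_norm k x).le)
    rw [fold S]
    · simp only [ch_add, Finset.mul_sum]
      rw [integral_finsetSum _ fun m _ => hint m]
    · intro m _
      simpa only [ch_add] using hint m
    · intro x hx m hm
      rw [hHK _ (hout x hx m hm), mul_zero]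
  have hmain := parsevalQ _ _ hPF hPG
  simp only [hco F hFm hFK, hco G hGm hGK] at hmain
  convert hmain using 1
  have hts : ∀ x ∈ Q d, ∀ n : Fin d → ℤ, ∑' m, G (x + iv n + iv m) = ∑ m ∈ S, G (x + iv m) := by
    intro x hx n
    rw [← tsum_eq_sum (L := .unconditional _) (f := fun m => G (x + iv m)) (fun m hm => hGK _ (hout x hx m hm))]
    rw [← (Equiv.addLeft n).tsum_eq (fun m => G (x + iv m))]
    refine tsum_congr fun m => ?_
    congr 1
    funext i
    simp [iv, add_assoc]
  have hint : ∀ m, IntegrableOn (fun x => (starRingEnd ℂ) (F (x + iv m)) * ∑ m ∈ S, G (x + iv m)) (Q d) :=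
    fun m => ((hFm m).star).integrable_mul hPG
  rw [fold S]
  · have : ∀ m, ∫ x in Q d, (starRingEnd ℂ) (F (x + iv m)) * ∑' n, G (x + iv m + iv n) =
        ∫ x in Q d, (starRingEnd ℂ) (F (x + iv m)) * ∑ m ∈ S, G (x + iv m) := fun m =>
      setIntegral_congr_fun (measQ d) fun x hx => by simp only [hts x hx m]
    simp only [this]
    rw [← integral_finsetSum _ fun m _ => hint m]
    simp only [map_sum, Finset.sum_mul]
  · intro m _
    exact (hint m).congr_fun (fun x hx => by simp only [hts x hx m]) (measQ d)
  · intro x hx m hm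
    rw [hFK _ (hout x hx m hm)]; simp

lemma cov {d : ℕ} (A : Matrix (Fin d) (Fin d) ℝ) (hA : A.det ≠ 0) (h : CF d) :
    ∫ x, h x = (|A.det| : ℝ) * ∫ t, h (A.mulVec t) := by
  have e : MeasurableEmbedding (Matrix.toLin' A) :=
    (LinearEquiv.toContinuousLinearEquiv (LinearMap.equivOfDetNeZero (Matrix.toLin' A)
      (by simpa using hA))).toHomeomorph.measurableEmbedding
  have h1 := e.integral_map (μ := volume) h
  rw [Real.map_matrix_volume_pi_eq_smul_volume_pi hA, integral_smul_measure] at h1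
  simp only [Matrix.toLin'_apply] at h1
  rw [← h1, ENNReal.toReal_ofReal (abs_nonneg _), abs_inv, Complex.real_smul, ← mul_assoc,
    ← Complex.ofReal_mul, mul_inv_cancel₀ (abs_ne_zero.2 hA)]
  simp

lemma locmul {d : ℕ} (f ψ : CF d) (hf : Continuous f) (hfs : HasCompactSupport f) (hψ : LocL2 ψ)
    (U : Matrix (Fin d) (Fin d) ℝ) (hU : IsUnit U.det) :
    MemLp (fun t => f (((2 * π) • U⁻¹).mulVec t) * ψ ((2 * π) • t)) 2 volume := by
  have h2 : (2 * π) ≠ 0 := by positivity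
  let K : Set (Fin d → ℝ) := (fun x => U.mulVec x) '' tsupport f
  have hK : IsCompact K := hfs.isCompact.image (Continuous.matrix_mulVec continuous_const continuous_id)
  have hUU : ∀ x, U.mulVec (U⁻¹.mulVec x) = x := fun x => by
    rw [Matrix.mulVec_mulVec, Matrix.mul_nonsing_inv _ hU, Matrix.one_mulVec]
  have h1 : MemLp (K.indicator ψ) 2 volume :=
    (memLp_indicator_iff_restrict hK.measurableSet).2 (hψ K hK)
  obtain ⟨C, hC⟩ := hf.bounded_above_of_compact_support hfs
  have h3 : MemLp (fun y => f (U⁻¹.mulVec y) * K.indicator ψ y) 2 volume := by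
    refine h1.of_le_mul (c := C) ?_ ?_
    · exact (hf.comp (Continuous.matrix_mulVec continuous_const continuous_id)).aestronglyMeasurable.mul h1.aestronglyMeasurable
    · refine Eventually.of_forall fun y => ?_
      rw [norm_mul]
      gcongr
      exact hC _
  have h4 : MemLp (fun y => f (U⁻¹.mulVec y) * ψ y) 2 volume := by
    convert h3 using 2 with y
    by_cases hy : y ∈ K
    · rw [Set.indicator_of_mem hy]
    · rw [image_eq_zero_of_notMem_tsupport (f := f)]
      · simp
      · intro h; exact hy ⟨_, h, hUU y⟩
  have h5 : MemLp (fun y => f (U⁻¹.mulVec y) * ψ y) 2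
      (Measure.map ((2 * π) • · : (Fin d → ℝ) → (Fin d → ℝ)) volume) := by
    rw [Measure.map_addHaar_smul volume h2]
    exact h4.smul_measure ENNReal.ofReal_ne_top
  have h6 := h5.comp_of_map (measurable_const_smul (2 * π)).aemeasurable
  convert h6 using 2 with t
  simp [Matrix.smul_mulVec, Matrix.mulVec_smul]

end S8

/-- for `ψ, ψ̃ ∈ L²_loc(ℝ^d)` and test functions `f, g`, the bracket series
`Σ_k ⟨f, ψ_{U;0,k}⟩⟨ψ̃_{U;0,k}, g⟩` converges absolutely and equals
`(2π)^d ∫ Σ_k f(ξ) conj(g(ξ+2πU⁻¹k)) conj(ψ(Uξ)) ψ̃(Uξ+2πk) dξ`, the inner sum having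
finitely many nonzero terms. -/
theorem statement8 {d : ℕ} (U : Matrix (Fin d) (Fin d) ℝ) (hU : IsUnit U.det)
    (ψ ψt : CF d) (hψ : LocL2 ψ) (hψt : LocL2 ψt)
    (f g : CF d) (hf : IsTest f) (hg : IsTest g) :
    Summable (fun k : Fin d → ℤ => ip f (fdil U k ψ) * ip (fdil U k ψt) g) ∧
    (∑' k : Fin d → ℤ, ip f (fdil U k ψ) * ip (fdil U k ψt) g)
      = (((2 * π) ^ d : ℝ) : ℂ) *
        ∫ ξ, ∑' k : Fin d → ℤ,
          f ξ * (starRingEnd ℂ) (g (ξ + (2 * π) • U⁻¹.mulVec (iv k))) *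
            (starRingEnd ℂ) (ψ (U.mulVec ξ)) * ψt (U.mulVec ξ + (2 * π) • iv k) ∧
    {k : Fin d → ℤ |
      ∃ ξ : Fin d → ℝ,
        f ξ * (starRingEnd ℂ) (g (ξ + (2 * π) • U⁻¹.mulVec (iv k))) ≠ 0}.Finite := by
  have h2 : (2 * π) ≠ 0 := by positivity
  have hUU : ∀ x, U.mulVec (U⁻¹.mulVec x) = x := fun x => by
    rw [Matrix.mulVec_mulVec, Matrix.mul_nonsing_inv _ hU, Matrix.one_mulVec]
  have hUU' : ∀ x, U⁻¹.mulVec (U.mulVec x) = x := fun x => by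
    rw [Matrix.mulVec_mulVec, Matrix.nonsing_inv_mul _ hU, Matrix.one_mulVec]
  set A : Matrix (Fin d) (Fin d) ℝ := (2 * π) • U⁻¹ with hA
  have hd : U.det ≠ 0 := hU.ne_zero
  have hAdet : A.det = (2 * π) ^ d * U.det⁻¹ := by
    rw [hA, Matrix.det_smul, Fintype.card_fin, Matrix.det_nonsing_inv, Ring.inverse_eq_inv']
  have hA0 : A.det ≠ 0 := by
    rw [hAdet]; exact mul_ne_zero (pow_ne_zero _ h2) (inv_ne_zero hd)
  have hUA : ∀ t, U.mulVec (A.mulVec t) = (2 * π) • t := fun t => by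
    rw [hA, Matrix.smul_mulVec, Matrix.mulVec_smul, hUU]
  have hAk : ∀ k, (2 * π) • U⁻¹.mulVec k = A.mulVec k := fun k => by
    rw [hA, Matrix.smul_mulVec]
  have hfc := hf.1.continuous
  have hgc := hg.1.continuous
  let f' : CF d := fun x => (starRingEnd ℂ) (f x)
  let g' : CF d := fun x => (starRingEnd ℂ) (g x)
  have hf's : HasCompactSupport f' := hf.2.comp_left (map_zero _)
  have hg's : HasCompactSupport g' := hg.2.comp_left (map_zero _)
  have hF := S8.locmul f' ψ (Complex.continuous_conj.comp hfc) hf's hψ U hU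
  have hG := S8.locmul g' ψt (Complex.continuous_conj.comp hgc) hg's hψt U hU
  rw [← hA] at hF hG
  let T : (Fin d → ℝ) → (Fin d → ℝ) := fun x => (2 * π)⁻¹ • U.mulVec x
  have hTc : Continuous T :=
    (continuous_const_smul (2 * π)⁻¹).comp (Continuous.matrix_mulVec continuous_const continuous_id)
  have hTA : ∀ t, T (A.mulVec t) = t := fun t => by
    simp only [T, hUA, smul_smul, inv_mul_cancel₀ h2, one_smul]
  have hK : IsCompact (T '' (tsupport f ∪ tsupport g)) :=
    (hf.2.isCompact.union hg.2.isCompact).image hTc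
  have hcore := S8.core _ _ hF hG _ hK
    (by
      intro t ht
      have : f (A.mulVec t) = 0 := image_eq_zero_of_notMem_tsupport fun h =>
        ht ⟨_, Or.inl h, hTA t⟩
      simp [f', this])
    (by
      intro t ht
      have : g (A.mulVec t) = 0 := image_eq_zero_of_notMem_tsupport fun h =>
        ht ⟨_, Or.inr h, hTA t⟩
      simp [g', this])
  have hdot : ∀ (k : Fin d → ℤ) (t : Fin d → ℝ), dotR (iv k) ((2 * π) • t) =
      2 * π * dotR (iv k) t := by
    intro k t
    simp only [dotR, Pi.smul_apply, smul_eq_mul, Finset.mul_sum]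
    exact Finset.sum_congr rfl fun i _ => by ring
  have hc1 : ∀ k, ip f (fdil U k ψ) = (|A.det| : ℝ) * ((Real.sqrt |U.det| : ℂ) *
      (starRingEnd ℂ) (∫ t, S8.ch k t * (f' (A.mulVec t) * ψ ((2 * π) • t)))) := by
    intro k
    rw [ip, S8.cov A hA0, ← integral_conj]
    congr 1
    rw [← integral_const_mul]
    refine integral_congr_ae (Eventually.of_forall fun t => ?_)
    simp only [fdil, hUA, hdot, S8.ch, f', map_mul, ← Complex.exp_conj, Complex.conj_ofReal,
      Complex.conj_conj, map_neg, Complex.conj_I, Complex.ofReal_mul, Complex.ofReal_ofNat,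
      Complex.conj_ofNat]
    ring_nf
  have hc2 : ∀ k, ip (fdil U k ψt) g = (|A.det| : ℝ) * ((Real.sqrt |U.det| : ℂ) *
      (∫ t, S8.ch k t * (g' (A.mulVec t) * ψt ((2 * π) • t)))) := by
    intro k
    rw [ip, S8.cov A hA0]
    congr 1
    rw [← integral_const_mul]
    refine integral_congr_ae (Eventually.of_forall fun t => ?_)
    simp only [fdil, hUA, hdot, S8.ch, g', Complex.ofReal_mul, Complex.ofReal_ofNat]
    ring_nf
  have hcc : ((|A.det| : ℝ) : ℂ) * (Real.sqrt |U.det| : ℂ) * (((|A.det| : ℝ) : ℂ) * (Real.sqrt |U.det| : ℂ))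
      = (((2 * π) ^ d : ℝ) : ℂ) * ((|A.det| : ℝ) : ℂ) := by
    norm_cast
    have h3 : |A.det| * |U.det| = (2 * π) ^ d := by
      rw [hAdet, abs_mul, abs_inv, mul_assoc, inv_mul_cancel₀ (abs_ne_zero.2 hd), mul_one,
        abs_of_nonneg (by positivity)]
    calc _ = |A.det| * (Real.sqrt |U.det| * Real.sqrt |U.det|) * |A.det| := by ring
      _ = _ := by rw [Real.mul_self_sqrt (abs_nonneg _), h3]
  have hs := hcore.mul_left ((((2 * π) ^ d : ℝ) : ℂ) * ((|A.det| : ℝ) : ℂ))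
  have hsum : HasSum (fun k : Fin d → ℤ => ip f (fdil U k ψ) * ip (fdil U k ψt) g)
      ((((2 * π) ^ d : ℝ) : ℂ) *
        ∫ ξ, ∑' k : Fin d → ℤ,
          f ξ * (starRingEnd ℂ) (g (ξ + (2 * π) • U⁻¹.mulVec (iv k))) *
            (starRingEnd ℂ) (ψ (U.mulVec ξ)) * ψt (U.mulVec ξ + (2 * π) • iv k)) := by
    rw [S8.cov A hA0, ← mul_assoc]
    have e3 : ∀ t, (∑' k : Fin d → ℤ, f (A.mulVec t) *
        (starRingEnd ℂ) (g (A.mulVec t + (2 * π) • U⁻¹.mulVec (iv k))) *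
        (starRingEnd ℂ) (ψ (U.mulVec (A.mulVec t))) * ψt (U.mulVec (A.mulVec t) + (2 * π) • iv k)) =
        (starRingEnd ℂ) (f' (A.mulVec t) * ψ ((2 * π) • t)) *
        ∑' (m : Fin d → ℤ), g' (A.mulVec (t + iv m)) * ψt ((2 * π) • (t + iv m)) := by
      intro t
      simp only [hUA, hAk, f', g', map_mul, Complex.conj_conj, ← Matrix.mulVec_add, ← smul_add]
      rw [← tsum_mul_left]
      refine tsum_congr fun k => ?_
      ring
    simp only [e3]
    refine HasSum.congr_fun hs fun k => ?_
    rw [hc1, hc2, ← hcc]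
    ring
  refine ⟨hsum.summable, hsum.tsum_eq, ?_⟩
  have hB : IsCompact (T '' ((fun p : (Fin d → ℝ) × (Fin d → ℝ) => p.1 - p.2) '' (tsupport g ×ˢ tsupport f))) :=
    ((hg.2.isCompact.prod hf.2.isCompact).image continuous_sub).image hTc
  refine (S8.ivfin _ hB.isBounded).subset ?_
  rintro k ⟨ξ, hξ⟩
  have h1 := left_ne_zero_of_mul hξ
  have h3 := right_ne_zero_of_mul hξ
  rw [hAk] at h3
  have h3 : g (ξ + A.mulVec (iv k)) ≠ 0 := fun h => h3 (by rw [h, map_zero])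
  exact ⟨A.mulVec (iv k), ⟨(ξ + A.mulVec (iv k), ξ), ⟨subset_tsupport _ h3, subset_tsupport _ h1⟩, by simp⟩, hTA _⟩
end
end

section
/- Let J ∈ ℤ and let N_j (j ≥ J) be d×d real-valued invertible matrices such that the set Λ := ∪_{j≥J} N_j^{-1}ℤ^d has no accumulation point and lim_{j→+∞} ‖N_j k‖ = 0 for every k ∈ Λ. Let Φ={φ^1,…,φ^r}, Φ̃={φ̃^1,…,φ̃^r} and Ψ_j={ψ^{j,1},…,ψ^{j,s_j}}, Ψ̃_j={ψ̃^{j,1},…,ψ̃^{j,s_j}} be finite subsets of locally square-integrable functions on ℝ^d. Then (FWS_J(Φ;{Ψ_j}_{j≥J}), FWS_J(Φ̃;{Ψ̃_j}_{j≥J})) is a pair of frequency-based nonstationary dual wavelet frames in the distribution space D'(ℝ^d) if and only if: (a) for every compactly supported C^∞ function h, lim_{J'→+∞} ⟨ I^0_Φ(N_J·) + Σ_{j=J}^{J'−1} I^0_{Ψ_j}(N_j·), h ⟩ = ⟨1, h⟩; and (b) for every k ∈ Λ∖{0}, I^{N_J k}_Φ(N_J ξ) + Σ_{j≥J} I^{N_j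 k}_{Ψ_j}(N_j ξ) = 0 for a.e. ξ ∈ ℝ^d (these sums having only finitely many nonzero terms). -/
open MeasureTheory Filter Complex Topology
open scoped Real

noncomputable section

/-- `(FWS_J(Φ;{Ψ_j}), FWS_J(Φ̃;{Ψ̃_j}))` is a pair of frequency-based nonstationary dual
wavelet frames in the distribution space `D'(ℝ^d)`: for all test functions `f, g`, all the
level-wise series converge absolutely, and the partial sums up to level `J'-1` converge to
`(2π)^d ⟨f,g⟩` as `J' → +∞`. -/
def DualDistr {d : ℕ} (N : ℤ → Matrix (Fin d) (Fin d) ℝ) (J : ℤ)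
    {ιΦ : Type} (Φ Φt : ιΦ → CF d)
    {ι : ℤ → Type} (Ψ Ψt : (j : ℤ) → ι j → CF d) : Prop :=
  ∀ f g : CF d, IsTest f → IsTest g →
    Summable (fun p : ιΦ × (Fin d → ℤ) =>
      ip f (fdil (N J) p.2 (Φ p.1)) * ip (fdil (N J) p.2 (Φt p.1)) g) ∧
    (∀ j : ℤ, J ≤ j → Summable (fun p : ι j × (Fin d → ℤ) =>
      ip f (fdil (N j) p.2 (Ψ j p.1)) * ip (fdil (N j) p.2 (Ψt j p.1)) g)) ∧
    Tendsto (fun n : ℕ =>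
        (∑' p : ιΦ × (Fin d → ℤ),
          ip f (fdil (N J) p.2 (Φ p.1)) * ip (fdil (N J) p.2 (Φt p.1)) g)
        + ∑ m ∈ Finset.range n, ∑' p : ι (J + (m : ℤ)) × (Fin d → ℤ),
            ip f (fdil (N (J + (m : ℤ))) p.2 (Ψ (J + (m : ℤ)) p.1)) *
              ip (fdil (N (J + (m : ℤ))) p.2 (Ψt (J + (m : ℤ)) p.1)) g)
      atTop (𝓝 ((((2 * π) ^ d : ℝ) : ℂ) * ip f g))

/-- The frame sum of the frequency-based nonstationary system `FWS_J(Φ;{Ψ_j})`. -/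
def nsSum {d : ℕ} (N : ℤ → Matrix (Fin d) (Fin d) ℝ) (J : ℤ)
    {ιΦ : Type} (Φ : ιΦ → CF d) {ι : ℤ → Type} (Ψ : (j : ℤ) → ι j → CF d)
    (f : CF d) : ℝ :=
  (∑' p : ιΦ × (Fin d → ℤ), ‖ip f (fdil (N J) p.2 (Φ p.1))‖ ^ 2)
    + ∑' (n : ℕ), ∑' p : ι (J + (n : ℤ)) × (Fin d → ℤ),
        ‖ip f (fdil (N (J + (n : ℤ))) p.2 (Ψ (J + (n : ℤ)) p.1))‖ ^ 2

open scoped Classical in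
/-- The bracket product `I^k_Φ(ξ) = Σ_ℓ conj(φ^ℓ(ξ)) φ̃^ℓ(ξ+2πk)` for `k ∈ ℤ^d`,
defined to be `0` for `k ∈ ℝ^d ∖ ℤ^d`. -/
def Ipair {d : ℕ} {ι : Type} [Fintype ι] (φ φt : ι → CF d)
    (k : Fin d → ℝ) (ξ : Fin d → ℝ) : ℂ :=
  if ∀ i, ∃ m : ℤ, k i = (m : ℝ) then
    ∑ ℓ, (starRingEnd ℂ) (φ ℓ ξ) * φt ℓ (ξ + (2 * π) • k)
  else 0



def ex {d : ℕ} (k : Fin d → ℤ) (x : Fin d → ℝ) : ℂ :=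
  Complex.exp (Complex.I * ((2 * π * dotR (iv k) x : ℝ) : ℂ))

def Qc (d : ℕ) : Set (Fin d → ℝ) := {x | ∀ i, x i ∈ Set.Ioc (0:ℝ) (0 + 1)}

lemma measurableSet_Qc (d : ℕ) : MeasurableSet (Qc d) :=
  MeasurableSet.univ_pi' (fun _ => measurableSet_Ioc)

lemma mFourier_eq_ex {d : ℕ} (k : Fin d → ℤ) (x : Fin d → ℝ) :
    UnitAddTorus.mFourier k (fun i => (x i : UnitAddCircle)) = ex k x := by
  simp only [UnitAddTorus.mFourier, ContinuousMap.coe_mk, fourier_coe_apply, ex, dotR, iv,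
    ← Complex.exp_sum]
  congr 1
  push_cast
  simp only [Finset.mul_sum]
  refine Finset.sum_congr rfl fun i _ => ?_
  ring

open UnitAddTorus in
lemma parseval_cube {d : ℕ} (u v : CF d) (hu : MemLp u 2 (volume.restrict (Qc d)))
    (hv : MemLp v 2 (volume.restrict (Qc d))) :
    HasSum (fun k : Fin d → ℤ => (∫ x in Qc d, u x * ex k x) *
      (starRingEnd ℂ) (∫ x in Qc d, v x * ex k x))
      (∫ x in Qc d, u x * (starRingEnd ℂ) (v x)) := by
  let s : UnitAddTorus (Fin d) → (Fin d → ℝ) :=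
    fun τ => (measurableEquivPiIoc (fun _ : Fin d => (0:ℝ)) τ).1
  have hmp := (measurePreserving_equivPiIoc (fun _ : Fin d => (0:ℝ)))
  have key : ∀ w : CF d, MemLp w 2 (volume.restrict (Qc d)) → 
      MemLp (w ∘ s) 2 (Measure.pi fun _ : Fin d => (AddCircle.haarAddCircle : Measure UnitAddCircle)) := by
    intro w hw
    have : MemLp (w ∘ (Subtype.val : {x : Fin d → ℝ // ∀ i, x i ∈ Set.Ioc (0:ℝ) (0 + 1)} → _)) 2 
        (Measure.comap Subtype.val volume) := by
      have := map_comap_subtype_coe (measurableSet_Qc d) (volume : Measure (Fin d → ℝ))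
      rw [← this] at hw
      exact ((MeasurableEmbedding.subtype_coe (measurableSet_Qc d)).memLp_map_measure_iff).1 hw
    exact this.comp_measurePreserving hmp
  have hs : ∀ x ∈ Qc d, s (fun i => (x i : UnitAddCircle)) = x := by
    intro x hx
    have := (measurableEquivPiIoc (fun _ : Fin d => (0:ℝ))).apply_symm_apply ⟨x, hx⟩
    exact congrArg Subtype.val this
  have hcoef : ∀ (w : CF d) (hw : MemLp w 2 (volume.restrict (Qc d))) (k : Fin d → ℤ),
      mFourierCoeff ((key w hw).toLp _) (-k) = ∫ x in Qc d, w x * ex k x := by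
    intro w hw k
    have h1 : mFourierCoeff ((key w hw).toLp _) (-k) = mFourierCoeff (w ∘ s) (-k) := by
      unfold mFourierCoeff
      refine integral_congr_ae ?_
      filter_upwards [(key w hw).coeFn_toLp] with τ hτ
      rw [hτ]
    rw [h1, mFourierCoeff_eq_integral _ _ (fun _ => 0)]
    refine setIntegral_congr_fun (measurableSet_Qc d) ?_
    intro x hx
    simp only [Function.comp, neg_neg]
    rw [hs x hx, mFourier_eq_ex, smul_eq_mul, mul_comm]
  have H := hasSum_prod_mFourierCoeff ((key v hv).toLp _) ((key u hu).toLp _)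
  rw [← (Equiv.neg (Fin d → ℤ)).hasSum_iff] at H
  convert H using 1
  · funext k
    simp only [Function.comp, Equiv.neg_apply]
    rw [hcoef u hu, hcoef v hv, mul_comm]
  · have : ∀ p : UnitAddTorus (Fin d) → ℂ, 
      (∫ τ, p τ ∂(Measure.pi fun _ : Fin d => (AddCircle.haarAddCircle : Measure UnitAddCircle))) = 
        ∫ x in Qc d, p (fun i => x i) := fun p => integral_preimage p (fun _ => 0)
    trans ∫ τ, (starRingEnd ℂ) (v (s τ)) * u (s τ) ∂(Measure.pi fun _ : Fin d => (AddCircle.haarAddCircle : Measure UnitAddCircle))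
    · rw [this]
      refine setIntegral_congr_fun (measurableSet_Qc d) ?_
      intro x hx
      simp only
      rw [hs x hx, mul_comm]
    · refine integral_congr_ae ?_
      filter_upwards [(key u hu).coeFn_toLp, (key v hv).coeFn_toLp] with τ h1 h2
      rw [h1, h2]; rfl

lemma unfold_int {d : ℕ} (F : CF d) (hF : Integrable F) :
    HasSum (fun n : Fin d → ℤ => ∫ t in Qc d, F (t + iv n)) (∫ x, F x) := by
  have hm : ∀ n : Fin d → ℤ, Measurable (fun x : Fin d → ℝ => x + iv n) := fun n =>
    measurable_id.add_const _
  let C : (Fin d → ℤ) → Set (Fin d → ℝ) := fun n => (fun x => x - iv n) ⁻¹' Qc d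
  have hC : ∀ n, MeasurableSet (C n) := fun n =>
    (measurable_id.sub_const _) (measurableSet_Qc d)
  have hmem : ∀ n x, x ∈ C n ↔ ∀ i, n i = ⌈x i⌉ - 1 := by
    intro n x
    simp only [C, Qc, iv, Set.mem_preimage, Set.mem_ofPred_eq, Pi.sub_apply, Set.mem_Ioc]
    refine forall_congr' fun i => ?_
    rw [eq_sub_iff_add_eq, eq_comm, Int.ceil_eq_iff]
    push_cast
    constructor <;> rintro ⟨h1, h2⟩ <;> constructor <;> linarith
  have hdisj : Pairwise (Function.onFun Disjoint C) := by
    intro n m hnm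
    refine Set.disjoint_left.2 fun x hx hy => hnm ?_
    funext i
    rw [(hmem n x).1 hx i, (hmem m x).1 hy i]
  have hU : (⋃ n, C n) = Set.univ := by
    refine Set.eq_univ_of_forall fun x => Set.mem_iUnion.2 ⟨fun i => ⌈x i⌉ - 1, ?_⟩
    rw [hmem]; intro i; rfl
  have := hasSum_integral_iUnion hC hdisj (f := F) (μ := volume) (by rw [hU]; exact hF.integrableOn)
  rw [hU, setIntegral_univ] at this
  refine this.congr_fun fun n => ?_
  have hp := measurePreserving_sub_right (volume : Measure (Fin d → ℝ)) (iv n)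
  have he : MeasurableEmbedding (fun x : Fin d → ℝ => x - iv n) := 
    (MeasurableEquiv.subRight (iv n)).measurableEmbedding
  rw [← hp.setIntegral_preimage_emb he]
  simp [C]


lemma iv_add {d : ℕ} (n m : Fin d → ℤ) : iv (n + m) = iv n + iv m := by
  funext i; simp [iv]

lemma ex_cont {d : ℕ} (k : Fin d → ℤ) : Continuous (ex k) := by
  unfold ex dotR; fun_prop

lemma ex_norm {d : ℕ} (k : Fin d → ℤ) (x) : ‖ex k x‖ = 1 := by
  unfold ex; rw [mul_comm]; exact Complex.norm_exp_ofReal_mul_I _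

lemma ex_add_iv {d : ℕ} (k n : Fin d → ℤ) (x) : ex k (x + iv n) = ex k x := by
  rw [← mFourier_eq_ex, ← mFourier_eq_ex]
  congr 1
  funext i
  simp [iv]

lemma exists_S {d : ℕ} (R : ℝ) : ∃ S : Finset (Fin d → ℤ), ∀ n, ∀ t ∈ Qc d, ‖t + iv n‖ ≤ R → n ∈ S := by
  refine ⟨Fintype.piFinset (fun _ => Finset.Icc (-(⌈R⌉+1)) (⌈R⌉+1)), fun n t ht h => ?_⟩
  rw [Fintype.mem_piFinset]
  intro i
  have h1 := (norm_le_pi_norm (t + iv n) i).trans h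
  have h2 := ht i
  rw [Real.norm_eq_abs, abs_le] at h1
  simp only [Pi.add_apply, iv, Set.mem_Ioc] at h1 h2
  have h3 := Int.le_ceil R
  rw [Finset.mem_Icc]
  constructor
  · have : ((-(⌈R⌉+1) : ℤ):ℝ) ≤ n i := by push_cast; linarith
    exact_mod_cast this
  · have : (n i : ℝ) ≤ ((⌈R⌉+1 : ℤ):ℝ) := by push_cast; linarith
    exact_mod_cast this

lemma memLp_translate {d : ℕ} {A : CF d} (hA : MemLp A 2) (c : Fin d → ℝ) :
    MemLp (fun t => A (t + c)) 2 :=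
  hA.comp_measurePreserving (measurePreserving_add_right volume c)

lemma integrable_of_supp {d : ℕ} {A : CF d} (hA : MemLp A 2) {R : ℝ} (hAR : ∀ x, R < ‖x‖ → A x = 0) :
    Integrable A := by
  have h1 : MemLp A 2 (volume.restrict (Metric.closedBall 0 R)) := hA.restrict _
  have : IsFiniteMeasure ((volume : Measure (Fin d → ℝ)).restrict (Metric.closedBall 0 R)) :=
    ⟨by rw [Measure.restrict_apply_univ]; exact (isCompact_closedBall _ _).measure_lt_top⟩
  have h2 : IntegrableOn A (Metric.closedBall 0 R) := h1.integrable (by norm_num)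
  refine h2.integrable_of_forall_notMem_eq_zero fun x hx => hAR x ?_
  simpa using hx

lemma parseval {d : ℕ} (A B : CF d) (hA : MemLp A 2) (hB : MemLp B 2) (R : ℝ)
    (hAR : ∀ x, R < ‖x‖ → A x = 0) (hBR : ∀ x, R < ‖x‖ → B x = 0) :
    HasSum (fun k : Fin d → ℤ => (∫ x, A x * ex k x) * (starRingEnd ℂ) (∫ x, B x * ex k x))
      (∑' p : Fin d → ℤ, ∫ x, A x * (starRingEnd ℂ) (B (x + iv p))) := by
  obtain ⟨S, hS⟩ := exists_S (d := d) R
  have hz : ∀ (C : CF d), (∀ x, R < ‖x‖ → C x = 0) → ∀ n ∉ S, ∀ t ∈ Qc d, C (t + iv n) = 0 := by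
    intro C hC n hn t ht
    by_contra h
    exact hn (hS n t ht (not_lt.1 fun h' => h (hC _ h')))
  have hunf : ∀ (C : CF d), Integrable C → (∀ x, R < ‖x‖ → C x = 0) →
      ∫ x, C x = ∑ n ∈ S, ∫ t in Qc d, C (t + iv n) := by
    intro C hC hC0
    rw [← (unfold_int C hC).tsum_eq, tsum_eq_sum]
    intro n hn
    rw [setIntegral_congr_fun (measurableSet_Qc d) (g := fun _ => 0) (fun t ht => hz C hC0 n hn t ht)]
    simp
  have hL : ∀ (C : CF d), MemLp C 2 → ∀ n : Fin d → ℤ, MemLp (fun t => C (t + iv n)) 2 (volume.restrict (Qc d)) :=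
    fun C hC n => (memLp_translate hC _).restrict _
  have hmem : ∀ (C : CF d), MemLp C 2 → MemLp (fun t => ∑ n ∈ S, C (t + iv n)) 2 (volume.restrict (Qc d)) := 
    fun C hC => memLp_finsetSum _ fun n _ => hL C hC n
  have hint : ∀ (C : CF d), MemLp C 2 → (∀ x, R < ‖x‖ → C x = 0) → ∀ k, Integrable (fun x => C x * ex k x) := by
    intro C hC hC0 k
    have := (integrable_of_supp hC hC0).bdd_mul (f := ex k) (c := 1) (ex_cont k).aestronglyMeasurable
      (ae_of_all _ fun x => (ex_norm k x).le)
    simpa only [mul_comm] using this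
  have hcoef : ∀ (C : CF d), MemLp C 2 → (∀ x, R < ‖x‖ → C x = 0) → ∀ k,
      ∫ t in Qc d, (∑ n ∈ S, C (t + iv n)) * ex k t = ∫ x, C x * ex k x := by
    intro C hC hC0 k
    rw [hunf _ (hint C hC hC0 k) (fun x hx => by rw [hC0 x hx, zero_mul])]
    simp only [ex_add_iv, Finset.sum_mul]
    refine integral_finsetSum _ fun n _ => ?_
    have := ((hint C hC hC0 k).comp_add_right (iv n)).integrableOn (s := Qc d)
    simp only [ex_add_iv] at this
    exact this
  have H := parseval_cube _ _ (hmem A hA) (hmem B hB)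
  simp only [hcoef A hA hAR, hcoef B hB hBR] at H
  convert H using 1
  set c : (Fin d → ℤ) → (Fin d → ℤ) → ℂ := fun n m =>
    ∫ t in Qc d, A (t + iv n) * (starRingEnd ℂ) (B (t + iv m)) with hc
  have hcz : ∀ n m, m ∉ S → c n m = 0 := by
    intro n m hm
    rw [hc]; simp only
    rw [setIntegral_congr_fun (measurableSet_Qc d) (g := fun _ => 0) (fun t ht => by
      simp only [hz B hBR m hm t ht, map_zero, mul_zero])]
    simp
  have e1 : ∀ p : Fin d → ℤ, ∫ x, A x * (starRingEnd ℂ) (B (x + iv p)) = ∑ n ∈ S, c n (n + p) := by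
    intro p
    rw [hunf (fun x => A x * (starRingEnd ℂ) (B (x + iv p)))
      (hA.integrable_mul (memLp_translate hB (iv p)).star) (fun x hx => by rw [hAR x hx, zero_mul])]
    refine Finset.sum_congr rfl fun n _ => ?_
    simp only [hc, iv_add, add_assoc]
  have e2 : ∀ n, HasSum (fun p => c n (n + p)) (∑ m ∈ S, c n m) := by
    intro n
    have : HasSum (c n) (∑ m ∈ S, c n m) := hasSum_sum_of_ne_finset_zero (fun m hm => hcz n m hm)
    exact (Equiv.addLeft n).hasSum_iff.2 this
  have e3 : ∑' p : Fin d → ℤ, ∫ x, A x * (starRingEnd ℂ) (B (x + iv p)) = ∑ n ∈ S, ∑ m ∈ S, c n m := by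
    simp only [e1]
    exact (hasSum_sum fun n _ => e2 n).tsum_eq
  rw [e3, Finset.sum_comm]
  simp only [map_sum, Finset.sum_mul, Finset.mul_sum]
  have hI : ∀ n m, Integrable (fun t => A (t + iv n) * (starRingEnd ℂ) (B (t + iv m)))
      (volume.restrict (Qc d)) := fun n m => (hL A hA n).integrable_mul (hL B hB m).star
  rw [integral_finsetSum _ fun m _ => integrable_finsetSum _ fun n _ => hI n m]
  refine Finset.sum_congr rfl fun m _ => ?_
  rw [integral_finsetSum _ fun n _ => hI n m]


lemma mulVec_inj {d : ℕ} {V : Matrix (Fin d) (Fin d) ℝ} (hV : V.det ≠ 0) :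
    Function.Injective V.mulVec := 
  Matrix.mulVec_injective_of_isUnit ((Matrix.isUnit_iff_isUnit_det _).2 hV.isUnit)

lemma mulVec_cont {d : ℕ} (V : Matrix (Fin d) (Fin d) ℝ) : Continuous V.mulVec := by
  fun_prop

lemma mulVec_cemb {d : ℕ} {V : Matrix (Fin d) (Fin d) ℝ} (hV : V.det ≠ 0) :
    IsClosedEmbedding V.mulVec := 
  LinearMap.isClosedEmbedding_of_injective (f := Matrix.toLin' V)
    (LinearMap.ker_eq_bot.2 (mulVec_inj hV))

lemma map_mulVec {d : ℕ} {V : Matrix (Fin d) (Fin d) ℝ} (hV : V.det ≠ 0) :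
    Measure.map V.mulVec volume = ENNReal.ofReal |V.det⁻¹| • volume := 
  Real.map_matrix_volume_pi_eq_smul_volume_pi hV

lemma cov {d : ℕ} {V : Matrix (Fin d) (Fin d) ℝ} (hV : V.det ≠ 0) (F : CF d) :
    ∫ x, F x = ((|V.det| : ℝ) : ℂ) * ∫ t, F (V.mulVec t) := by
  have h := (mulVec_cemb hV).measurableEmbedding.integral_map (μ := volume) F
  rw [← h, map_mulVec hV, integral_smul_measure, ENNReal.toReal_ofReal (abs_nonneg _), abs_inv,
    Complex.real_smul, ← mul_assoc]
  have : ((|V.det| : ℝ) : ℂ) ≠ 0 := by simpa using hV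
  push_cast
  rw [mul_inv_cancel₀ this, one_mul]

lemma LocL2.comp_lin {d : ℕ} {h : CF d} (hh : LocL2 h) {V : Matrix (Fin d) (Fin d) ℝ}
    (hV : V.det ≠ 0) : LocL2 (fun x => h (V.mulVec x)) := by
  intro K hK
  have hK' : IsCompact (V.mulVec '' K) := hK.image (mulVec_cont V)
  have h1 := (memLp_indicator_iff_restrict hK'.measurableSet).2 (hh _ hK')
  have h2 : MemLp ((V.mulVec '' K).indicator h) 2 (Measure.map V.mulVec volume) := by
    rw [map_mulVec hV]
    exact h1.smul_measure ENNReal.ofReal_ne_top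
  rw [(mulVec_cemb hV).measurableEmbedding.memLp_map_measure_iff] at h2
  rw [← memLp_indicator_iff_restrict hK.measurableSet]
  refine (memLp_congr_ae (ae_of_all _ fun x => ?_)).1 h2
  have : V.mulVec x ∈ V.mulVec '' K ↔ x ∈ K := (mulVec_inj hV).mem_set_image
  simp only [Function.comp]
  by_cases hx : x ∈ K
  · rw [Set.indicator_of_mem hx, Set.indicator_of_mem (this.2 hx)]
  · rw [Set.indicator_of_notMem hx, Set.indicator_of_notMem (fun h => hx (this.1 h))]

lemma LocL2.comp_add {d : ℕ} {h : CF d} (hh : LocL2 h) (c : Fin d → ℝ) :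
    LocL2 (fun x => h (x + c)) := by
  intro K hK
  have hK' : IsCompact ((fun x => x + c) '' K) := hK.image (by fun_prop)
  have h1 := (memLp_indicator_iff_restrict hK'.measurableSet).2 (hh _ hK')
  have h2 := memLp_translate h1 c
  rw [← memLp_indicator_iff_restrict hK.measurableSet]
  refine (memLp_congr_ae (ae_of_all _ fun x => ?_)).1 h2
  have : x + c ∈ (fun x => x + c) '' K ↔ x ∈ K := (add_left_injective c).mem_set_image
  by_cases hx : x ∈ K
  · rw [Set.indicator_of_mem hx, Set.indicator_of_mem (this.2 hx)]
  · rw [Set.indicator_of_notMem hx, Set.indicator_of_notMem (fun h => hx (this.1 h))]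

lemma IsTest.cont {d : ℕ} {f : CF d} (hf : IsTest f) : Continuous f := hf.1.continuous

lemma IsTest.memLp_mul {d : ℕ} {f h : CF d} (hf : IsTest f) (hh : LocL2 h) :
    MemLp (fun x => f x * (starRingEnd ℂ) (h x)) 2 := by
  have hK : IsCompact (tsupport f) := hf.2
  have h1 := (memLp_indicator_iff_restrict hK.measurableSet).2 (hh _ hK).star
  have h2 : MemLp f ⊤ := hf.cont.memLp_top_of_hasCompactSupport hf.2 volume
  have h3 := h1.mul (r := 2) h2
  refine (memLp_congr_ae (ae_of_all _ fun x => ?_)).1 h3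
  simp only [Pi.mul_apply, Set.indicator]
  split_ifs with hx
  · rfl
  · rw [image_eq_zero_of_notMem_tsupport hx]; simp

lemma IsTest.comp_lin {d : ℕ} {f : CF d} (hf : IsTest f) {V : Matrix (Fin d) (Fin d) ℝ}
    (hV : V.det ≠ 0) : IsTest (fun x => f (V.mulVec x)) :=
  ⟨hf.1.comp (Matrix.toLin' V).toContinuousLinearMap.contDiff,
    hf.2.comp_isClosedEmbedding (mulVec_cemb hV)⟩

lemma IsTest.comp_add {d : ℕ} {f : CF d} (hf : IsTest f) (c : Fin d → ℝ) :
    IsTest (fun x => f (x + c)) :=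
  ⟨hf.1.comp (contDiff_id.add contDiff_const),
    hf.2.comp_homeomorph (Homeomorph.addRight c)⟩

lemma IsTest.conj {d : ℕ} {f : CF d} (hf : IsTest f) : IsTest (fun x => (starRingEnd ℂ) (f x)) :=
  ⟨Complex.conjCLE.contDiff.comp hf.1, hf.2.comp_left (g := starRingEnd ℂ) (map_zero _)⟩

lemma IsTest.mul {d : ℕ} {f g : CF d} (hf : IsTest f) (hg : IsTest g) : IsTest (fun x => f x * g x) :=
  ⟨hf.1.mul hg.1, hf.2.mul_right⟩

lemma IsTest.bound {d : ℕ} {f : CF d} (hf : IsTest f) : ∃ R : ℝ, ∀ x, R < ‖x‖ → f x = 0 := by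
  obtain ⟨R, hR⟩ := (IsCompact.isBounded hf.2).subset_closedBall 0
  refine ⟨R, fun x hx => image_eq_zero_of_notMem_tsupport fun h => ?_⟩
  have := hR h
  simp at this
  linarith

lemma LocL2.locInt {d : ℕ} {f h : CF d} (hf : LocL2 f) (hh : LocL2 h) :
    LocallyIntegrable (fun x => (starRingEnd ℂ) (f x) * h x) := by
  rw [locallyIntegrable_iff]
  intro K hK
  exact (hf K hK).star.integrable_mul (hh K hK)

lemma IsTest.int {d : ℕ} {f h : CF d} (hf : IsTest f) (hh : LocallyIntegrable h) :
    Integrable (fun x => f x * h x) :=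
  hh.integrable_smul_left_of_hasCompactSupport hf.cont hf.2

lemma ip_conj {d : ℕ} (f g : CF d) : ip f g = (starRingEnd ℂ) (ip g f) := by
  unfold ip
  rw [← integral_conj]
  simp [mul_comm]

lemma dot_smul {d : ℕ} (k : Fin d → ℝ) (c : ℝ) (x : Fin d → ℝ) : dotR k (c • x) = c * dotR k x := by
  simp only [dotR, Finset.mul_sum, Pi.smul_apply, smul_eq_mul]
  exact Finset.sum_congr rfl fun i _ => by ring

lemma UV {d : ℕ} {U : Matrix (Fin d) (Fin d) ℝ} (hU : IsUnit U.det) (t : Fin d → ℝ) :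
    U.mulVec (((2 * π) • U⁻¹).mulVec t) = (2 * π) • t := by
  rw [Matrix.smul_mulVec, Matrix.mulVec_smul, Matrix.mulVec_mulVec, Matrix.mul_nonsing_inv _ hU,
    Matrix.one_mulVec]

lemma detV {d : ℕ} {U : Matrix (Fin d) (Fin d) ℝ} (_hU : IsUnit U.det) : 
    ((2 * π) • U⁻¹).det = (2 * π) ^ d * (U.det)⁻¹ := by
  rw [Matrix.det_smul, Matrix.det_nonsing_inv, Ring.inverse_eq_inv', Fintype.card_fin]

lemma detV_ne {d : ℕ} {U : Matrix (Fin d) (Fin d) ℝ} (hU : IsUnit U.det) : 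
    ((2 * π) • U⁻¹).det ≠ 0 := by
  rw [detV hU]
  have := Real.pi_pos
  have := hU.ne_zero
  positivity

lemma ip_fdil {d : ℕ} {U : Matrix (Fin d) (Fin d) ℝ} (hU : IsUnit U.det) (f φ : CF d) (k : Fin d → ℤ) :
    ip f (fdil U k φ) = (Real.sqrt |U.det| : ℂ) * ((|((2 * π) • U⁻¹).det| : ℝ) : ℂ) *
      ∫ t, (f (((2 * π) • U⁻¹).mulVec t) * 
        (starRingEnd ℂ) (φ (U.mulVec (((2 * π) • U⁻¹).mulVec t)))) * ex k t := by
  unfold ip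
  rw [cov (detV_ne hU), mul_comm (Real.sqrt |U.det| : ℂ), mul_assoc]
  congr 1
  rw [← integral_const_mul]
  congr 1
  funext t
  simp only [fdil, ex, map_mul, ← Complex.exp_conj, map_neg, Complex.conj_I, Complex.conj_ofReal, UV hU, neg_neg,
    dot_smul]
  ring

lemma level1 {d : ℕ} {U : Matrix (Fin d) (Fin d) ℝ} (hU : IsUnit U.det) {f g φ φt : CF d}
    (hf : IsTest f) (hg : IsTest g) (hφ : LocL2 φ) (hφt : LocL2 φt) :
    HasSum (fun k : Fin d → ℤ => ip f (fdil U k φ) * ip (fdil U k φt) g)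
      ((((2 * π) ^ d : ℝ) : ℂ) * ∑' k : Fin d → ℤ, ∫ x, 
        (f x * (starRingEnd ℂ) (g (x + (2 * π) • U⁻¹.mulVec (iv k)))) *
         ((starRingEnd ℂ) (φ (U.mulVec x)) * φt (U.mulVec x + (2 * π) • iv k))) := by
  set V := (2 * π) • U⁻¹ with hV
  have hVd : V.det ≠ 0 := detV_ne hU
  obtain ⟨R1, hR1⟩ := (hf.comp_lin hVd).bound
  obtain ⟨R2, hR2⟩ := (hg.comp_lin hVd).bound
  have hA := (hf.comp_lin hVd).memLp_mul ((hφ.comp_lin hU.ne_zero).comp_lin hVd)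
  have hB := (hg.comp_lin hVd).memLp_mul ((hφt.comp_lin hU.ne_zero).comp_lin hVd)
  have H := parseval _ _ hA hB (max R1 R2)
    (fun x hx => by rw [hR1 x ((le_max_left _ _).trans_lt hx), zero_mul])
    (fun x hx => by rw [hR2 x ((le_max_right _ _).trans_lt hx), zero_mul])
  have H2 := H.mul_left (((|U.det| * |V.det| * |V.det| : ℝ)) : ℂ)
  have hdet : |U.det| * |V.det| = (2 * π) ^ d := by
    rw [hV, detV hU, abs_mul, abs_inv, mul_comm, mul_assoc, inv_mul_cancel₀ (abs_ne_zero.2 hU.ne_zero),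
      mul_one, abs_of_pos (by have := Real.pi_pos; positivity)]
  have key : (((2 * π) ^ d : ℝ) : ℂ) * (∑' k : Fin d → ℤ, ∫ x, 
        (f x * (starRingEnd ℂ) (g (x + (2 * π) • U⁻¹.mulVec (iv k)))) *
         ((starRingEnd ℂ) (φ (U.mulVec x)) * φt (U.mulVec x + (2 * π) • iv k))) =
      ((|U.det| * |V.det| * |V.det| : ℝ) : ℂ) * ∑' p : Fin d → ℤ,
        ∫ x, f (V.mulVec x) * (starRingEnd ℂ) (φ (U.mulVec (V.mulVec x))) *
            (starRingEnd ℂ) (g (V.mulVec (x + iv p)) *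
              (starRingEnd ℂ) (φt (U.mulVec (V.mulVec (x + iv p))))) := by
    rw [hdet, Complex.ofReal_mul, mul_assoc]
    congr 1
    rw [← tsum_mul_left]
    congr 1
    funext k
    rw [cov hVd]
    congr 2
    funext t
    have e : V.mulVec (t + iv k) = V.mulVec t + (2 * π) • U⁻¹.mulVec (iv k) := by
      rw [Matrix.mulVec_add, hV, Matrix.smul_mulVec _ _ (iv k)]
    have e2 : U.mulVec (V.mulVec (t + iv k)) = U.mulVec (V.mulVec t) + (2 * π) • iv k := by
      rw [Matrix.mulVec_add, Matrix.mulVec_add, UV hU (iv k)]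
    simp only [map_mul, Complex.conj_conj]
    rw [e2, e]
    ring
  rw [key]
  refine H2.congr_fun fun k => ?_
  rw [ip_conj _ g, ip_fdil hU, ip_fdil hU]
  simp only [map_mul, Complex.conj_ofReal]
  have : (Real.sqrt |U.det| : ℂ) * (Real.sqrt |U.det| : ℂ) = (|U.det| : ℝ) := by
    rw [← Complex.ofReal_mul, Real.mul_self_sqrt (abs_nonneg _)]
  push_cast
  rw [← this]
  ring


lemma Ipair_iv {d : ℕ} {ι : Type} [Fintype ι] (φ φt : ι → CF d) (k : Fin d → ℤ) (ξ : Fin d → ℝ) :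
    Ipair φ φt (iv k) ξ = ∑ ℓ, (starRingEnd ℂ) (φ ℓ ξ) * φt ℓ (ξ + (2 * π) • iv k) := by
  unfold Ipair
  rw [if_pos]
  exact fun i => ⟨k i, rfl⟩

lemma Ipair_not {d : ℕ} {ι : Type} [Fintype ι] (φ φt : ι → CF d) (k : Fin d → ℝ)
    (hk : ¬ ∃ m : Fin d → ℤ, k = iv m) (ξ : Fin d → ℝ) :
    Ipair φ φt k ξ = 0 := by
  unfold Ipair
  rw [if_neg]
  intro h
  choose m hm using h
  exact hk ⟨m, funext hm⟩

lemma mulVec_inv_cancel {d : ℕ} {U : Matrix (Fin d) (Fin d) ℝ} (hU : IsUnit U.det) (t : Fin d → ℝ) :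
    U.mulVec (U⁻¹.mulVec t) = t := by
  rw [Matrix.mulVec_mulVec, Matrix.mul_nonsing_inv _ hU, Matrix.one_mulVec]

lemma mulVec_cancel_inv {d : ℕ} {U : Matrix (Fin d) (Fin d) ℝ} (hU : IsUnit U.det) (t : Fin d → ℝ) :
    U⁻¹.mulVec (U.mulVec t) = t := by
  rw [Matrix.mulVec_mulVec, Matrix.nonsing_inv_mul _ hU, Matrix.one_mulVec]

lemma pair_locInt {d : ℕ} {U : Matrix (Fin d) (Fin d) ℝ} (hU : IsUnit U.det) {φ φt : CF d}
    (hφ : LocL2 φ) (hφt : LocL2 φt) (c : Fin d → ℝ) :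
    LocallyIntegrable (fun x => (starRingEnd ℂ) (φ (U.mulVec x)) * φt (U.mulVec x + c)) :=
  (hφ.comp_lin hU.ne_zero).locInt ((hφt.comp_add c).comp_lin hU.ne_zero)

lemma Ipair_locInt {d : ℕ} {U : Matrix (Fin d) (Fin d) ℝ} (hU : IsUnit U.det) {s : ℕ}
    {φ φt : Fin s → CF d} (hφ : ∀ ℓ, LocL2 (φ ℓ)) (hφt : ∀ ℓ, LocL2 (φt ℓ)) (k : Fin d → ℝ) :
    LocallyIntegrable (fun x => Ipair φ φt k (U.mulVec x)) := by
  by_cases hk : ∃ m : Fin d → ℤ, k = iv m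
  · obtain ⟨m, rfl⟩ := hk
    simp only [Ipair_iv]
    exact locallyIntegrable_finsetSum _ fun ℓ _ => pair_locInt hU (hφ ℓ) (hφt ℓ) _
  · simp only [Ipair_not φ φt k hk]
    exact locallyIntegrable_const 0

lemma iv_inj {d : ℕ} : Function.Injective (iv : (Fin d → ℤ) → (Fin d → ℝ)) := by
  intro a b h
  funext i
  have := congrFun h i
  simpa [iv] using this

lemma level {d : ℕ} {U : Matrix (Fin d) (Fin d) ℝ} (hU : IsUnit U.det) {s : ℕ}
    {φ φt : Fin s → CF d} (hφ : ∀ ℓ, LocL2 (φ ℓ)) (hφt : ∀ ℓ, LocL2 (φt ℓ))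
    {f g : CF d} (hf : IsTest f) (hg : IsTest g) (F : Finset (Fin d → ℝ))
    (hF : ∀ k : Fin d → ℤ, ∀ x, f x * (starRingEnd ℂ) (g (x + (2 * π) • U⁻¹.mulVec (iv k))) ≠ 0 →
      U⁻¹.mulVec (iv k) ∈ F) :
    HasSum (fun p : Fin s × (Fin d → ℤ) => ip f (fdil U p.2 (φ p.1)) * ip (fdil U p.2 (φt p.1)) g)
      ((((2 * π) ^ d : ℝ) : ℂ) * ∑ y ∈ F, ∫ x, (f x * (starRingEnd ℂ) (g (x + (2 * π) • y))) *
        Ipair φ φt (U.mulVec y) (U.mulVec x)) := by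
  set i : (Fin d → ℤ) → (Fin d → ℝ) := fun k => U⁻¹.mulVec (iv k) with hi
  have hinj : Function.Injective i := by
    intro a b h
    have : U.mulVec (i a) = U.mulVec (i b) := by rw [h]
    simp only [hi, mulVec_inv_cancel hU] at this
    exact iv_inj this
  have h1 := fun ℓ => level1 hU hf hg (hφ ℓ) (hφt ℓ)
  have hsum : Summable (fun p : Fin s × (Fin d → ℤ) => 
      ip f (fdil U p.2 (φ p.1)) * ip (fdil U p.2 (φt p.1)) g) := by
    refine Summable.of_norm ?_
    rw [summable_prod_of_nonneg (fun _ => norm_nonneg _)]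
    exact ⟨fun ℓ => (h1 ℓ).summable.norm, Summable.of_finite⟩
  set c : (Fin d → ℝ) → ℂ := fun y => ∫ x, (f x * (starRingEnd ℂ) (g (x + (2 * π) • y))) *
        Ipair φ φt (U.mulVec y) (U.mulVec x) with hc
  set b : Fin s → (Fin d → ℤ) → ℂ := fun ℓ k => ∫ x, 
        (f x * (starRingEnd ℂ) (g (x + (2 * π) • U⁻¹.mulVec (iv k)))) *
         ((starRingEnd ℂ) (φ ℓ (U.mulVec x)) * φt ℓ (U.mulVec x + (2 * π) • iv k)) with hb
  have hbz : ∀ ℓ k, i k ∉ F → b ℓ k = 0 := by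
    intro ℓ k hk
    have : ∀ x, f x * (starRingEnd ℂ) (g (x + (2 * π) • U⁻¹.mulVec (iv k))) = 0 := fun x => by
      by_contra h
      exact hk (hF k x h)
    simp [hb, this]
  have hbs : ∀ ℓ, Summable (b ℓ) := by
    intro ℓ
    refine summable_of_hasFiniteSupport ((F.finite_toSet.preimage hinj.injOn).subset ?_)
    intro k hk
    by_contra h
    exact hk (hbz ℓ k h)
  have hcb : ∀ k, c (i k) = ∑ ℓ, b ℓ k := by
    intro k
    simp only [hc, hb, hi, mulVec_inv_cancel hU, Ipair_iv, Finset.mul_sum]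
    refine integral_finsetSum _ fun ℓ _ => ?_
    exact (hf.mul (hg.comp_add _).conj).int (pair_locInt hU (hφ ℓ) (hφt ℓ) _)
  have hcr : Function.support c ⊆ Set.range i := by
    intro y hy
    by_contra h
    refine hy ?_
    have : ¬ ∃ m : Fin d → ℤ, U.mulVec y = iv m := by
      rintro ⟨m, hm⟩
      exact h ⟨m, by simp only [hi]; rw [← hm, mulVec_cancel_inv hU]⟩
    simp [hc, Ipair_not φ φt _ this]
  have hcF : ∀ y, y ∉ F → c y = 0 := by
    intro y hy
    by_contra h
    obtain ⟨k, rfl⟩ := hcr h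
    rw [hcb] at h
    exact h (Finset.sum_eq_zero fun ℓ _ => hbz ℓ k hy)
  have e : ∑ y ∈ F, c y = ∑ ℓ, ∑' k, b ℓ k := by
    have e0 : ∑' y, c y = ∑ y ∈ F, c y := tsum_eq_sum hcF
    rw [← e0, ← hinj.tsum_eq hcr,
      ← Summable.tsum_finsetSum (fun ℓ _ => hbs ℓ)]
    exact tsum_congr hcb
  rw [e, Finset.mul_sum]
  have e2 := hsum.hasSum
  rw [hsum.tsum_prod, tsum_fintype] at e2
  have e3 : ∀ ℓ, ∑' k, ip f (fdil U k (φ ℓ)) * ip (fdil U k (φt ℓ)) g = 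
    (((2 * π) ^ d : ℝ) : ℂ) * ∑' k, b ℓ k := fun ℓ => (h1 ℓ).tsum_eq
  simp only [e3] at e2
  exact e2


/-- characterization of a pair of frequency-based nonstationary dual wavelet
frames in the distribution space. -/
theorem statement10 {d : ℕ} (J : ℤ) (N : ℤ → Matrix (Fin d) (Fin d) ℝ)
    (hNinv : ∀ j : ℤ, J ≤ j → IsUnit (N j).det)
    (Λ : Set (Fin d → ℝ))
    (hΛ : Λ = {x : Fin d → ℝ | ∃ j : ℤ, J ≤ j ∧ ∃ k : Fin d → ℤ,
      x = (N j)⁻¹.mulVec (iv k)})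
    (hacc : ∀ x : Fin d → ℝ, ¬ AccPt x (Filter.principal Λ))
    (hlim : ∀ x ∈ Λ, Tendsto (fun n : ℕ => ‖(N (J + (n : ℤ))).mulVec x‖) atTop (𝓝 0))
    {r : ℕ} (Φ Φt : Fin r → CF d)
    {s : ℤ → ℕ} (Ψ Ψt : (j : ℤ) → Fin (s j) → CF d)
    (hΦ : ∀ ℓ, LocL2 (Φ ℓ)) (hΦt : ∀ ℓ, LocL2 (Φt ℓ))
    (hΨ : ∀ j : ℤ, J ≤ j → ∀ ℓ, LocL2 (Ψ j ℓ))
    (hΨt : ∀ j : ℤ, J ≤ j → ∀ ℓ, LocL2 (Ψt j ℓ)) :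
    DualDistr N J Φ Φt Ψ Ψt ↔
      ((∀ h : CF d, IsTest h →
        Tendsto (fun n : ℕ =>
            ∫ ξ, (Ipair Φ Φt 0 ((N J).mulVec ξ)
              + ∑ m ∈ Finset.range n,
                  Ipair (Ψ (J + (m : ℤ))) (Ψt (J + (m : ℤ))) 0
                    ((N (J + (m : ℤ))).mulVec ξ)) * (starRingEnd ℂ) (h ξ))
          atTop (𝓝 (∫ ξ, (starRingEnd ℂ) (h ξ)))) ∧
       (∀ x ∈ Λ, x ≠ 0 → ∀ᵐ ξ : Fin d → ℝ,
          Ipair Φ Φt ((N J).mulVec x) ((N J).mulVec ξ)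
            + (∑' n : ℕ,
                Ipair (Ψ (J + (n : ℤ))) (Ψt (J + (n : ℤ)))
                  ((N (J + (n : ℤ))).mulVec x) ((N (J + (n : ℤ))).mulVec ξ)) = 0)) := by

  have hJ : ∀ m : ℕ, J ≤ J + (m : ℤ) := fun m => by omega
  have h2π : (1:ℝ) ≤ 2 * π := by have := Real.pi_gt_three; linarith
  have hC : (((2 * π) ^ d : ℝ) : ℂ) ≠ 0 := by
    have := Real.pi_pos
    exact Complex.ofReal_ne_zero.2 (by positivity)
  have h0Λ : (0 : Fin d → ℝ) ∈ Λ := by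
    rw [hΛ]
    refine ⟨J, le_rfl, 0, ?_⟩
    have : iv (0 : Fin d → ℤ) = 0 := by funext i; simp [iv]
    rw [this, Matrix.mulVec_zero]
  -- partial symbols
  set T : ℕ → (Fin d → ℝ) → (Fin d → ℝ) → ℂ := fun n y x =>
    Ipair Φ Φt ((N J).mulVec y) ((N J).mulVec x) + ∑ m ∈ Finset.range n,
      Ipair (Ψ (J + (m : ℤ))) (Ψt (J + (m : ℤ))) ((N (J + (m : ℤ))).mulVec y)
        ((N (J + (m : ℤ))).mulVec x) with hT
  set Ti : (Fin d → ℝ) → (Fin d → ℝ) → ℂ := fun y x =>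
    Ipair Φ Φt ((N J).mulVec y) ((N J).mulVec x) + ∑' m : ℕ,
      Ipair (Ψ (J + (m : ℤ))) (Ψt (J + (m : ℤ))) ((N (J + (m : ℤ))).mulVec y)
        ((N (J + (m : ℤ))).mulVec x) with hTi
  set P : ℕ → CF d → CF d → ℂ := fun n f g =>
    (∑' p : Fin r × (Fin d → ℤ),
          ip f (fdil (N J) p.2 (Φ p.1)) * ip (fdil (N J) p.2 (Φt p.1)) g)
        + ∑ m ∈ Finset.range n, ∑' p : Fin (s (J + (m : ℤ))) × (Fin d → ℤ),
            ip f (fdil (N (J + (m : ℤ))) p.2 (Ψ (J + (m : ℤ)) p.1)) *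
              ip (fdil (N (J + (m : ℤ))) p.2 (Ψt (J + (m : ℤ)) p.1)) g with hP
  have hI0 : ∀ y, LocallyIntegrable (fun x => Ipair Φ Φt ((N J).mulVec y) ((N J).mulVec x)) :=
    fun y => Ipair_locInt (hNinv J le_rfl) hΦ hΦt _
  have hI1 : ∀ (m : ℕ) y, LocallyIntegrable (fun x => Ipair (Ψ (J + (m : ℤ))) (Ψt (J + (m : ℤ)))
      ((N (J + (m : ℤ))).mulVec y) ((N (J + (m : ℤ))).mulVec x)) :=
    fun m y => Ipair_locInt (hNinv _ (hJ m)) (hΨ _ (hJ m)) (hΨt _ (hJ m)) _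
  have hTl : ∀ n y, LocallyIntegrable (T n y) := fun n y =>
    (hI0 y).add (locallyIntegrable_finsetSum _ fun m _ => hI1 m y)
  have hPF : ∀ f g : CF d, IsTest f → IsTest g → ∀ F : Finset (Fin d → ℝ),
      (∀ y ∈ Λ, ∀ x, f x * (starRingEnd ℂ) (g (x + (2 * π) • y)) ≠ 0 → y ∈ F) → ∀ n,
      P n f g = (((2 * π) ^ d : ℝ) : ℂ) * ∑ y ∈ F,
        ∫ x, (f x * (starRingEnd ℂ) (g (x + (2 * π) • y))) * T n y x := by
    intro f g hf hg F hF n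
    have hw : ∀ y, IsTest (fun x => f x * (starRingEnd ℂ) (g (x + (2 * π) • y))) := fun y =>
      hf.mul (hg.comp_add _).conj
    have hmem : ∀ j : ℤ, J ≤ j → ∀ k : Fin d → ℤ, (N j)⁻¹.mulVec (iv k) ∈ Λ := by
      intro j hj k
      rw [hΛ]
      exact ⟨j, hj, k, rfl⟩
    have a0 := (level (hNinv J le_rfl) hΦ hΦt hf hg F
      (fun k x h => hF _ (hmem J le_rfl k) x h)).tsum_eq
    have a1 := fun m : ℕ => (level (hNinv _ (hJ m)) (hΨ _ (hJ m)) (hΨt _ (hJ m)) hf hg F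
      (fun k x h => hF _ (hmem _ (hJ m) k) x h)).tsum_eq
    simp only [hP]
    rw [a0, Finset.sum_congr rfl (fun m _ => a1 m), ← Finset.mul_sum, ← mul_add, Finset.sum_comm,
      ← Finset.sum_add_distrib]
    congr 1
    refine Finset.sum_congr rfl fun y _ => ?_
    simp only [hT, mul_add, Finset.mul_sum]
    rw [integral_add ((hw y).int (hI0 y)) (integrable_finsetSum _ fun m _ => (hw y).int (hI1 m y)),
      integral_finsetSum _ fun m _ => (hw y).int (hI1 m y)]
  have hPsum : ∀ f g : CF d, IsTest f → IsTest g → ∃ F : Finset (Fin d → ℝ),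
      0 ∈ F ∧ (∀ y ∈ F, y ∈ Λ) ∧
      (∀ y ∈ Λ, ∀ x, f x * (starRingEnd ℂ) (g (x + (2 * π) • y)) ≠ 0 → y ∈ F) := by
    intro f g hf hg
    obtain ⟨R1, hR1⟩ := hf.bound
    obtain ⟨R2, hR2⟩ := hg.bound
    have hfin : (Λ ∩ Metric.closedBall 0 (R1 + R2)).Finite := by
      by_contra h
      obtain ⟨x, -, hx⟩ := Set.Infinite.exists_accPt_of_subset_isCompact h
        (isCompact_closedBall 0 (R1 + R2)) Set.inter_subset_right
      exact hacc x (hx.mono (principal_mono.2 Set.inter_subset_left))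
    classical
    refine ⟨insert 0 hfin.toFinset, Finset.mem_insert_self _ _, ?_, ?_⟩
    · intro y hy
      rcases Finset.mem_insert.1 hy with rfl | hy
      · exact h0Λ
      · exact ((hfin.mem_toFinset).1 hy).1
    · intro y hy x hx
      refine Finset.mem_insert_of_mem ((hfin.mem_toFinset).2 ⟨hy, ?_⟩)
      have b1 : ‖x‖ ≤ R1 := by
        by_contra h
        exact hx (by rw [hR1 x (not_le.1 h), zero_mul])
      have b2 : ‖x + (2 * π) • y‖ ≤ R2 := by
        by_contra h
        exact hx (by rw [hR2 _ (not_le.1 h), map_zero, mul_zero])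
      have b3 : ‖(2 * π) • y‖ ≤ R1 + R2 := by
        have : (2 * π) • y = (x + (2 * π) • y) - x := by abel
        rw [this]
        exact (norm_sub_le _ _).trans (by linarith)
      rw [norm_smul, Real.norm_of_nonneg (by linarith)] at b3
      rw [mem_closedBall_zero_iff]
      nlinarith [norm_nonneg y]
  have hsummable : ∀ f g : CF d, IsTest f → IsTest g → 
      Summable (fun p : Fin r × (Fin d → ℤ) =>
      ip f (fdil (N J) p.2 (Φ p.1)) * ip (fdil (N J) p.2 (Φt p.1)) g) ∧
    (∀ j : ℤ, J ≤ j → Summable (fun p : Fin (s j) × (Fin d → ℤ) =>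
      ip f (fdil (N j) p.2 (Ψ j p.1)) * ip (fdil (N j) p.2 (Ψt j p.1)) g)) := by
    intro f g hf hg
    obtain ⟨F, -, -, hF⟩ := hPsum f g hf hg
    have hmem : ∀ j : ℤ, J ≤ j → ∀ k : Fin d → ℤ, (N j)⁻¹.mulVec (iv k) ∈ Λ := by
      intro j hj k
      rw [hΛ]
      exact ⟨j, hj, k, rfl⟩
    exact ⟨(level (hNinv J le_rfl) hΦ hΦt hf hg F
      (fun k x h => hF _ (hmem J le_rfl k) x h)).summable,
      fun j hj => (level (hNinv _ hj) (hΨ _ hj) (hΨt _ hj) hf hg F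
      (fun k x h => hF _ (hmem _ hj k) x h)).summable⟩
  have hev : ∀ y ∈ Λ, y ≠ 0 → ∀ᶠ n in atTop, ∀ x, T n y x = Ti y x := by
    intro y hy hy0
    obtain ⟨n0, hn0⟩ := eventually_atTop.1 ((hlim y hy).eventually_lt_const (zero_lt_one))
    filter_upwards [eventually_ge_atTop n0] with n hn x
    simp only [hT, hTi]
    rw [tsum_eq_sum (s := Finset.range n)]
    intro m hm
    rw [Finset.mem_range, not_lt] at hm
    refine Ipair_not _ _ _ ?_ _
    rintro ⟨k, hk⟩
    have h1 := hn0 m (hn.trans hm)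
    rw [hk] at h1
    have h2 : k = 0 := by
      funext i
      have h3 := (norm_le_pi_norm (iv k) i).trans_lt h1
      simp only [iv, Real.norm_eq_abs] at h3
      have h4 : |k i| < 1 := by exact_mod_cast h3
      simpa using Int.abs_lt_one_iff.1 h4
    have h3 : iv (0 : Fin d → ℤ) = 0 := by funext i; simp [iv]
    rw [h2, h3] at hk
    exact hy0 (mulVec_inj (hNinv _ (hJ m)).ne_zero (hk.trans (Matrix.mulVec_zero _).symm))
  have hdiag : (∀ y ∈ Λ, y ≠ 0 → ∀ᵐ x : Fin d → ℝ, Ti y x = 0) → ∀ f g : CF d, IsTest f → IsTest g →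
      ∀ᶠ n in atTop, (((2 * π) ^ d : ℝ) : ℂ) * ∫ x, T n 0 x * (f x * (starRingEnd ℂ) (g x)) = P n f g := by
    intro hb f g hf hg
    obtain ⟨F, h0F, hFΛ, hF⟩ := hPsum f g hf hg
    have : ∀ᶠ n in atTop, ∀ y ∈ F, y ≠ 0 → ∀ x, T n y x = Ti y x := by
      rw [Finset.eventually_all]
      intro y hy
      by_cases h : y = 0
      · simp [h]
      · filter_upwards [hev y (hFΛ y hy) h] with n hn _ using hn
    filter_upwards [this] with n hn
    rw [hPF f g hf hg F hF n]
    congr 1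
    rw [Finset.sum_eq_single_of_mem 0 h0F]
    · simp only [smul_zero, add_zero]
      congr 1
      funext x
      ring
    · intro y hy hy0
      refine integral_eq_zero_of_ae ?_
      filter_upwards [hb y (hFΛ y hy) hy0] with x hx
      rw [hn y hy hy0 x, hx, mul_zero]
      rfl
  have hoff : DualDistr N J Φ Φt Ψ Ψt → ∀ y ∈ Λ, y ≠ 0 → ∀ᵐ x : Fin d → ℝ, Ti y x = 0 := by
    intro hD y hy hy0
    have hTil : LocallyIntegrable (Ti y) := by
      obtain ⟨n, hn⟩ := (hev y hy hy0).exists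
      have : T n y = Ti y := funext hn
      rw [← this]
      exact hTl n y
    obtain ⟨ε, hε, hεΛ⟩ : ∃ ε > 0, ∀ z ∈ Λ, ‖z - y‖ < ε → z = y := by
      have := hacc y
      rw [accPt_iff_frequently, not_frequently] at this
      obtain ⟨ε, hε, h⟩ := Metric.eventually_nhds_iff.1 this
      refine ⟨ε, hε, fun z hz hzy => ?_⟩
      by_contra hne
      exact h (by rwa [dist_eq_norm]) ⟨hne, hz⟩
    have hyn : 0 < ‖y‖ := norm_pos_iff.2 hy0
    set δ := min ε ‖y‖ / 3 with hδ
    have hδ0 : 0 < δ := by positivity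
    have hδ1 : 3 * δ ≤ ε := by rw [hδ]; linarith [min_le_left ε ‖y‖]
    have hδ2 : 3 * δ ≤ ‖y‖ := by rw [hδ]; linarith [min_le_right ε ‖y‖]
    have hloc : ∀ x0 : Fin d → ℝ, ∀ᵐ x : Fin d → ℝ, x ∈ Metric.ball x0 δ → Ti y x = 0 := by
      intro x0
      refine IsOpen.ae_eq_zero_of_integral_contDiff_smul_eq_zero Metric.isOpen_ball
        (hTil.locallyIntegrableOn _) ?_
      intro w hw1 hw2 hw3
      let b : ContDiffBump (x0 + (2 * π) • y) := ⟨δ, 2 * δ, hδ0, by linarith⟩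
      have hf : IsTest (fun x => (w x : ℂ)) :=
        ⟨Complex.ofRealCLM.contDiff.comp hw1, hw2.comp_left (g := Complex.ofReal) rfl⟩
      have hg : IsTest (fun x => ((b x : ℝ) : ℂ)) :=
        ⟨Complex.ofRealCLM.contDiff.comp b.contDiff, b.hasCompactSupport.comp_left (g := Complex.ofReal) rfl⟩
      have hwx : ∀ x, w x ≠ 0 → ‖x - x0‖ < δ := by
        intro x hx
        have := hw3 (subset_tsupport _ hx)
        rwa [Metric.mem_ball, dist_eq_norm] at this
      have hbx : ∀ x, b x ≠ 0 → ‖x - (x0 + (2 * π) • y)‖ < 2 * δ := by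
        intro x hx
        by_contra h
        refine hx (b.zero_of_le_dist ?_)
        rw [dist_eq_norm]
        exact not_lt.1 h
      have hF : ∀ z ∈ Λ, ∀ x, ((w x : ℝ) : ℂ) * (starRingEnd ℂ) ((b (x + (2 * π) • z) : ℝ) : ℂ) ≠ 0 → 
          z ∈ ({y} : Finset (Fin d → ℝ)) := by
        intro z hz x hx
        rw [Finset.mem_singleton]
        have c1 := hwx x (fun h => hx (by simp [h]))
        have c2 := hbx (x + (2 * π) • z) (fun h => hx (by simp [h]))
        refine hεΛ z hz ?_
        have c3 : ‖(2 * π) • (z - y)‖ < 3 * δ := by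
          have : (2 * π) • (z - y) = (x + (2 * π) • z - (x0 + (2 * π) • y)) - (x - x0) := by
            rw [smul_sub]; abel
          rw [this]
          exact (norm_sub_le _ _).trans_lt (by linarith)
        rw [norm_smul, Real.norm_of_nonneg (by linarith)] at c3
        nlinarith [norm_nonneg (z - y)]
      have hip : ip (fun x => (w x : ℂ)) (fun x => ((b x : ℝ) : ℂ)) = 0 := by
        unfold ip
        refine integral_eq_zero_of_ae (ae_of_all _ fun x => ?_)
        by_contra hx
        have c1 := hwx x (fun h => hx (by simp [h]))
        have c2 := hbx x (fun h => hx (by simp [h]))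
        have c3 : ‖(2 * π) • y‖ < 3 * δ := by
          have : (2 * π) • y = (x - x0) - (x - (x0 + (2 * π) • y)) := by abel
          rw [this]
          exact (norm_sub_le _ _).trans_lt (by linarith)
        rw [norm_smul, Real.norm_of_nonneg (by linarith)] at c3
        nlinarith [norm_nonneg y]
      have hlim1 := (hD _ _ hf hg).2.2
      rw [hip, mul_zero] at hlim1
      have hlim2 : Tendsto (fun n => P n (fun x => (w x : ℂ)) (fun x => ((b x : ℝ) : ℂ))) atTop 
          (𝓝 ((((2 * π) ^ d : ℝ) : ℂ) * ∫ x, w x • Ti y x)) := by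
        refine tendsto_const_nhds.congr' ?_
        filter_upwards [hev y hy hy0] with n hn
        rw [hPF _ _ hf hg {y} hF n, Finset.sum_singleton]
        congr 2
        funext x
        rw [hn, Complex.real_smul]
        by_cases hx : w x = 0
        · simp [hx]
        · have : b (x + (2 * π) • y) = 1 := by
            refine b.one_of_mem_closedBall ?_
            rw [Metric.mem_closedBall, dist_add_right, dist_eq_norm]
            exact (hwx x hx).le
          rw [this]
          simp
      have := tendsto_nhds_unique hlim1 hlim2
      exact (mul_eq_zero.1 this.symm).resolve_left hC
    rw [ae_iff]
    refine measure_null_of_locally_null _ fun x0 _ => ?_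
    refine ⟨Metric.ball x0 δ ∩ {x | ¬ Ti y x = 0}, ?_, ?_⟩
    · exact inter_mem (mem_nhdsWithin_of_mem_nhds (Metric.ball_mem_nhds _ hδ0)) self_mem_nhdsWithin
    · have := hloc x0
      rw [ae_iff] at this
      refine measure_mono_null ?_ this
      rintro x ⟨h1, h2⟩ h3
      exact h2 (h3 h1)
  have hT0 : ∀ n x, T n 0 x = Ipair Φ Φt 0 ((N J).mulVec x)
              + ∑ m ∈ Finset.range n,
                  Ipair (Ψ (J + (m : ℤ))) (Ψt (J + (m : ℤ))) 0
                    ((N (J + (m : ℤ))).mulVec x) := by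
    intro n x
    simp only [hT, Matrix.mulVec_zero]
  simp only [← hT0]
  constructor
  · intro hD
    refine ⟨?_, hoff hD⟩
    intro h hh
    obtain ⟨R, hR⟩ := hh.bound
    let b : ContDiffBump (0 : Fin d → ℝ) := ⟨max R 0 + 1, max R 0 + 2, by positivity, by linarith⟩
    have hf : IsTest (fun x => ((b x : ℝ) : ℂ)) :=
        ⟨Complex.ofRealCLM.contDiff.comp b.contDiff, b.hasCompactSupport.comp_left (g := Complex.ofReal) rfl⟩
    have hbh : ∀ x, ((b x : ℝ) : ℂ) * (starRingEnd ℂ) (h x) = (starRingEnd ℂ) (h x) := by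
      intro x
      by_cases hx : h x = 0
      · simp [hx]
      · have : b x = 1 := by
          refine b.one_of_mem_closedBall ?_
          rw [mem_closedBall_zero_iff]
          have : ‖x‖ ≤ R := not_lt.1 fun h' => hx (hR x h')
          exact this.trans ((le_max_left R 0).trans (by simp [b]))
        simp [this]
    have h1 := (hD _ _ hf hh).2.2
    have h2 := h1.congr' ((hdiag (hoff hD) _ _ hf hh).mono fun n hn => hn.symm)
    simp only [ip, hbh] at h2
    have h3 := h2.const_mul ((((2 * π) ^ d : ℝ) : ℂ)⁻¹)
    simpa only [inv_mul_cancel_left₀ hC] using h3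
  · rintro ⟨ha, hb⟩ f g hf hg
    refine ⟨(hsummable f g hf hg).1, (hsummable f g hf hg).2, ?_⟩
    have h1 := ha _ (hf.conj.mul hg)
    simp only [map_mul, Complex.conj_conj] at h1
    exact (h1.const_mul _).congr' (hdiag hb f g hf hg)
end
end
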